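/- arXiv:2202.04108 — 4 statements merged into one kernel-verified Lean document; each statement's English description precedes it below -/
import Mathlib

section
/- Let X and Y be measurable spaces, μ a probability measure on X × Y, H a set of functions f : X → Y, and ℓ, ℓ' : Y × Y → ℝ loss functions. Fix a measurable constraint function ε₀ : X → ℝ, a real number P₀, and a measurable dual function λ* : X → ℝ with λ*(x) ≥ 0 for μ-almost every (x,y). Assume strong duality holds at ε₀ with dual optimum λ* and optimal value P₀, in the sense that for every f ∈ H (with the relevant integrands μ-integrable), ∫ (ℓ(f(x), y) + λ*(x)·(ℓ'(f(x), y) − ε₀(x))) dμ ≥ P₀. Then for every measurable ε : X → ℝ such that x ↦ λ*(x)·(ε(x) − ε₀(x)) is μ-integrable, and every f ∈ H that is ε-feasible (ℓ'(f(x), y) ≤ ε(x) for μ-almost every (x, y)) with (x,y) ↦ ℓ(f(x), y) and (x,y) ↦ λ*(x)·(ℓ'(f(x), y) − ε(x)) μ-integrable, one has ∫ ℓ(f(x), y) dμ ≥ P₀ − ∫ λ*(x)·(ε(x) − ε₀(x)) dμ. In particular, the optimal value P*(ε) of the ε-perturbed problem satisfies P*(ε) − P*(ε₀) ≥ −∫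 λ*·(ε − ε₀) dμ, i.e., −λ* is a subgradient of the perturbation function ε ↦ P*(ε) at ε₀. -/
open MeasureTheory

/-- Subgradient form of Theorem 1 (sensitivity of the optimal value of the constrained
statistical learning problem): if strong duality holds at `ε₀` with dual optimum `lam`
and optimal value `P₀`, then for any perturbed constraint function `ε`, every `ε`-feasible
hypothesis has objective value at least `P₀ - ∫ lam * (ε - ε₀)`; i.e. `-lam` is a
subgradient of the perturbation function at `ε₀`. -/
theorem csl_sensitivity_subgradient
    {X Y : Type*} [MeasurableSpace X] [MeasurableSpace Y]
    (μ : Measure (X × Y)) [IsProbabilityMeasure μ]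
    (H : Set (X → Y)) (ℓ ℓ' : Y × Y → ℝ)
    (ε₀ : X → ℝ) (hε₀_meas : Measurable ε₀) (P₀ : ℝ)
    (lam : X → ℝ) (hlam_meas : Measurable lam)
    (hlam_nonneg : ∀ᵐ p ∂μ, 0 ≤ lam p.1)
    (hstrong_dual : ∀ f ∈ H,
      Integrable (fun p => ℓ (f p.1, p.2)) μ →
      Integrable (fun p => lam p.1 * (ℓ' (f p.1, p.2) - ε₀ p.1)) μ →
      P₀ ≤ ∫ p, (ℓ (f p.1, p.2) + lam p.1 * (ℓ' (f p.1, p.2) - ε₀ p.1)) ∂μ) :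
    ∀ ε : X → ℝ, Measurable ε →
      Integrable (fun p => lam p.1 * (ε p.1 - ε₀ p.1)) μ →
      ∀ f ∈ H,
        (∀ᵐ p ∂μ, ℓ' (f p.1, p.2) ≤ ε p.1) →
        Integrable (fun p => ℓ (f p.1, p.2)) μ →
        Integrable (fun p => lam p.1 * (ℓ' (f p.1, p.2) - ε p.1)) μ →
        P₀ - ∫ p, lam p.1 * (ε p.1 - ε₀ p.1) ∂μ ≤ ∫ p, ℓ (f p.1, p.2) ∂μ := by
  intro ε _ hε f hf hfeas hℓ hslack
  have hsplit : (fun p : X × Y => lam p.1 * (ℓ' (f p.1, p.2) - ε₀ p.1)) =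
      fun p => lam p.1 * (ℓ' (f p.1, p.2) - ε p.1) + lam p.1 * (ε p.1 - ε₀ p.1) := by
    funext p
    ring
  have hslack₀ : Integrable (fun p => lam p.1 * (ℓ' (f p.1, p.2) - ε₀ p.1)) μ :=
    hsplit ▸ hslack.add hε
  have hdual := hstrong_dual f hf hℓ hslack₀
  rw [integral_add hℓ hslack₀, hsplit, integral_add hslack hε] at hdual
  have hnonpos : ∫ p, lam p.1 * (ℓ' (f p.1, p.2) - ε p.1) ∂μ ≤ 0 := by
    refine integral_nonpos_of_ae ?_
    filter_upwards [hlam_nonneg, hfeas] with p hlam hle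
    exact mul_nonpos_of_nonneg_of_nonpos hlam (sub_nonpos.mpr hle)
  linarith
end

section
/- Let X and Y be measurable spaces, μ a probability measure on X × Y, H a set of functions f : X → Y, ℓ, ℓ' : Y × Y → ℝ loss functions, ε₀ : X → ℝ measurable, and P₀ ∈ ℝ. Let λ* : X → ℝ be measurable with λ*(x) ≥ 0 for μ-almost every (x,y), and suppose: (i) for every f ∈ H, ∫ (ℓ(f(x), y) + λ*(x)·(ℓ'(f(x), y) − ε₀(x))) dμ ≥ P₀ (λ* is dual optimal with value P₀); (ii) f* ∈ H is ε₀-feasible, i.e., ℓ'(f*(x), y) ≤ ε₀(x) for μ-almost every (x, y), and primal optimal: ∫ ℓ(f*(x), y) dμ = P₀; (iii) the functions (x,y) ↦ ℓ(f*(x), y) and (x,y) ↦ λ*(x)·(ℓ'(f*(x), y) − ε₀(x)) are μ-integrable. Then complementary slackness holds μ-almost everywhere: λ*(x)·(ℓ'(f*(x), y) − ε₀(x)) = 0 for μ-almost every (x, y). In particular, λ*(x) = 0 almost everywhere on the set where the constraint is inactive (ℓ'(f*(x), y) < ε₀(x)). -/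
open MeasureTheory

/-- Complementary slackness for the constrained statistical learning problem: if `lam` is
dual optimal with value `P₀` and `fstar` is a feasible primal optimal hypothesis, then
`lam x * (ℓ' (fstar x, y) - ε₀ x) = 0` for `μ`-almost every `(x, y)`. In particular the
dual variable vanishes almost everywhere on the set where the constraint is inactive. -/
theorem csl_complementary_slackness
    {X Y : Type*} [MeasurableSpace X] [MeasurableSpace Y]
    (μ : Measure (X × Y)) [IsProbabilityMeasure μ]
    (H : Set (X → Y)) (ℓ ℓ' : Y × Y → ℝ)
    (ε₀ : X → ℝ) (hε₀_meas : Measurable ε₀) (P₀ : ℝ)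
    (lam : X → ℝ) (hlam_meas : Measurable lam)
    (hlam_nonneg : ∀ᵐ p ∂μ, 0 ≤ lam p.1)
    (hdual_opt : ∀ f ∈ H,
      P₀ ≤ ∫ p, (ℓ (f p.1, p.2) + lam p.1 * (ℓ' (f p.1, p.2) - ε₀ p.1)) ∂μ)
    (fstar : X → Y) (hfstar : fstar ∈ H)
    (hfeas : ∀ᵐ p ∂μ, ℓ' (fstar p.1, p.2) ≤ ε₀ p.1)
    (hprimal_opt : ∫ p, ℓ (fstar p.1, p.2) ∂μ = P₀)
    (hint_obj : Integrable (fun p => ℓ (fstar p.1, p.2)) μ)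
    (hint_con : Integrable (fun p => lam p.1 * (ℓ' (fstar p.1, p.2) - ε₀ p.1)) μ) :
    ∀ᵐ p ∂μ, lam p.1 * (ℓ' (fstar p.1, p.2) - ε₀ p.1) = 0 := by
  have hdual := hdual_opt fstar hfstar
  rw [integral_add hint_obj hint_con, hprimal_opt] at hdual
  have hnonpos : ∀ᵐ p ∂μ, lam p.1 * (ℓ' (fstar p.1, p.2) - ε₀ p.1) ≤ 0 := by
    filter_upwards [hlam_nonneg, hfeas] with p hlam hle
    exact mul_nonpos_of_nonneg_of_nonpos hlam (sub_nonpos.2 hle)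
  have hzero : ∫ p, lam p.1 * (ℓ' (fstar p.1, p.2) - ε₀ p.1) ∂μ = 0 :=
    le_antisymm (integral_nonpos_of_ae hnonpos) (by linarith)
  have hneg : ∫ p, -(lam p.1 * (ℓ' (fstar p.1, p.2) - ε₀ p.1)) ∂μ = 0 := by
    rw [integral_neg, hzero, neg_zero]
  have hae := (integral_eq_zero_iff_of_nonneg_ae
    (hnonpos.mono fun p hp => neg_nonneg.2 hp) hint_con.neg).1 hneg
  exact hae.mono fun p hp => neg_eq_zero.1 hp
end

section
/- Let Θ be a nonempty set, ℓ : Θ → ℝ an objective function, n a natural number, and g : Θ → (Fin n → ℝ) a family of n constraint functions. For ε : Fin n → ℝ let F(ε) = {θ ∈ Θ : ∀ i, g(θ) i ≤ ε i} and let v(ε) = sInf (ℓ '' F(ε)) be the value function, where ℓ is bounded below on Θ and F(ε) is nonempty for every ε in a neighborhood of ε₀. Suppose λ* : Fin n → ℝ satisfies λ* i ≥ 0 for all i and for every θ ∈ Θ: ℓ(θ) + ∑_i λ* i · (g(θ) i − ε₀ i) ≥ v(ε₀) (strong duality at ε₀ with dual optimum λ*). If v, viewed as a function on EuclideanSpace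 ℝ (Fin n), has gradient G at ε₀ (HasGradientAt v G ε₀), then G = −λ*; that is, ∂v/∂ε_i (ε₀) = −λ*_i for every i. -/
/-- Theorem 1 of the paper in finite-constraint (CERM) derivative form: for a strongly dual
constrained problem, if the value function `v ε = sInf (ℓ '' {θ | ∀ i, g θ i ≤ ε i})`
has a gradient `G` at `ε₀`, then `G = -lam`, where `lam` is the optimal dual variable:
the derivative of the optimal value with respect to the `i`-th constraint level is
`-lam i`. -/
theorem cerm_value_gradient_eq_neg_dual
    {Θ : Type*} [Nonempty Θ] (ℓ : Θ → ℝ) (n : ℕ) (g : Θ → Fin n → ℝ)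
    (F : EuclideanSpace ℝ (Fin n) → Set Θ)
    (hF : ∀ ε, F ε = {θ : Θ | ∀ i, g θ i ≤ ε i})
    (v : EuclideanSpace ℝ (Fin n) → ℝ) (hv : ∀ ε, v ε = sInf (ℓ '' F ε))
    (hbdd : BddBelow (Set.range ℓ))
    (ε₀ : EuclideanSpace ℝ (Fin n))
    (hfeas_nhds : ∀ᶠ ε in nhds ε₀, (F ε).Nonempty)
    (lam : EuclideanSpace ℝ (Fin n)) (hlam_nonneg : ∀ i, 0 ≤ lam i)
    (hstrong_dual : ∀ θ : Θ, v ε₀ ≤ ℓ θ + ∑ i, lam i * (g θ i - ε₀ i))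
    (G : EuclideanSpace ℝ (Fin n)) (hG : HasGradientAt v G ε₀) :
    G = -lam := by
  have hmin : IsLocalMin (fun ε => v ε + inner ℝ lam ε) ε₀ := by
    filter_upwards [hfeas_nhds] with ε hε
    suffices h : v ε₀ + inner ℝ lam ε₀ - inner ℝ lam ε ≤ v ε by linarith
    rw [hv ε]
    refine le_csInf (hε.image ℓ) ?_
    rintro _ ⟨θ, hθ, rfl⟩
    rw [hF] at hθ
    have hsum : ∑ i, lam i * (g θ i - ε₀ i) ≤ ∑ i, lam i * (ε i - ε₀ i) :=
      Finset.sum_le_sum fun i _ =>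
        mul_le_mul_of_nonneg_left (sub_le_sub_right (hθ i) _) (hlam_nonneg i)
    have hinner : ∑ i, lam i * (ε i - ε₀ i) = inner ℝ lam ε - inner ℝ lam ε₀ := by
      simp [PiLp.inner_apply, mul_sub, mul_comm]
    linarith [hstrong_dual θ]
  have hzero := hmin.hasFDerivAt_eq_zero
    (hG.hasFDerivAt.add (innerSL ℝ lam).hasFDerivAt)
  refine eq_neg_of_add_eq_zero_left (ext_inner_right ℝ fun x => ?_)
  simpa [inner_add_left] using DFunLike.congr_fun hzero x
end

section
/- Let E be a real vector space, Θ ⊆ E a nonempty convex set, ℓ : E → ℝ convex on Θ, n a natural number, and g : E → (Fin n → ℝ) with each component gᵢ convex on Θ. Fix ε : Fin n → ℝ and suppose Slater's condition holds: there exists θ̃ ∈ Θ with g(θ̃) i < ε i for every i. Suppose the primal optimal value is finite: there is p₀ ∈ ℝ such that ℓ(θ) ≥ p₀ for every ε-feasible θ ∈ Θ (i.e., every θ ∈ Θ with g(θ) i ≤ ε i for all i), and p₀ is the infimum of ℓ over the ε-feasible set. Then strong duality holds and the dual optimum is attained: there exists λ* : Fin n → ℝ with λ* i ≥ 0 for all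 i such that for every θ ∈ Θ, ℓ(θ) + ∑_i λ* i · (g(θ) i − ε i) ≥ p₀; consequently sInf {ℓ(θ) + ∑_i λ* i · (g(θ) i − ε i) : θ ∈ Θ} = p₀. -/
section SlaterCondition

variable {E ι : Type*} {s : Set E} {f : E → ℝ} {h : E → ι → ℝ}

/-- The strict upper set of the values of `(h, f)` on `s`. -/
def strictValueSet (s : Set E) (f : E → ℝ) (h : E → ι → ℝ) : Set ((ι → ℝ) × ℝ) :=
  {p | ∃ x ∈ s, (∀ i, h x i < p.1 i) ∧ f x < p.2}

theorem isOpen_strictValueSet [Finite ι] : IsOpen (strictValueSet s f h) := by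
  have key : strictValueSet s f h =
      ⋃ x ∈ s, (Set.univ.pi fun i => Set.Ioi (h x i)) ×ˢ Set.Ioi (f x) := by
    ext p
    simp [strictValueSet, and_left_comm]
  rw [key]
  exact isOpen_biUnion fun x _ =>
    (isOpen_set_pi Set.finite_univ fun i _ => isOpen_Ioi).prod isOpen_Ioi

variable [AddCommGroup E] [Module ℝ E]

theorem ConvexOn.convex_strictValueSet (hf : ConvexOn ℝ s f)
    (hh : ∀ i, ConvexOn ℝ s fun x => h x i) : Convex ℝ (strictValueSet s f h) := by
  rintro p ⟨x, hx, hxp, hfx⟩ q ⟨y, hy, hyq, hfy⟩ a b ha hb hab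
  have combine_lt {c d c' d' : ℝ} (hc : c < c') (hd : d < d') :
      a * c + b * d < a * c' + b * d' := by
    have := (convex_Ioi (0 : ℝ)) (sub_pos.2 hc) (sub_pos.2 hd) ha hb hab
    simp only [smul_eq_mul, Set.mem_Ioi] at this
    linarith
  refine ⟨a • x + b • y, hf.1 hx hy ha hb hab, fun i => ?_, ?_⟩
  · exact ((hh i).2 hx hy ha hb hab).trans_lt (combine_lt (hxp i) (hyq i))
  · exact (hf.2 hx hy ha hb hab).trans_lt (combine_lt hfx hfy)

/-- **Existence of Lagrange multipliers** under Slater's condition. -/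
theorem ConvexOn.exists_lagrange_multiplier [Fintype ι] (hf : ConvexOn ℝ s f)
    (hh : ∀ i, ConvexOn ℝ s fun x => h x i) (hs : ∃ x ∈ s, ∀ i, h x i < 0) {p : ℝ}
    (hp : ∀ x ∈ s, (∀ i, h x i ≤ 0) → p ≤ f x) :
    ∃ lam : ι → ℝ, (∀ i, 0 ≤ lam i) ∧ ∀ x ∈ s, p ≤ f x + ∑ i, lam i * h x i := by
  classical
  have hnot : ((0 : ι → ℝ), p) ∉ strictValueSet s f h := by
    rintro ⟨x, hx, hhx, hfx⟩
    exact (hp x hx fun i => (hhx i).le).not_gt hfx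
  obtain ⟨φ, hφ⟩ := geometric_hahn_banach_point_open
    (hf.convex_strictValueSet hh) isOpen_strictValueSet hnot
  set r := φ (0, 1) with hr
  set μ : ι → ℝ := fun i => φ (Pi.single i 1, 0) with hμ
  have hφ_apply (u : ι → ℝ) (t : ℝ) : φ (u, t) = ∑ i, μ i * u i + r * t := by
    have hdecomp : (u, t) = ∑ i, u i • (Pi.single i (1 : ℝ), (0 : ℝ)) + t • ((0 : ι → ℝ), 1) := by
      ext j
      · simp [Prod.fst_sum, Finset.sum_apply, Pi.single_apply]
      · simp [Prod.snd_sum]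
    rw [hdecomp]
    simp only [map_add, map_sum, map_smul, smul_eq_mul, hμ, hr, mul_comm]
  have hsep (u : ι → ℝ) (t : ℝ) (hut : (u, t) ∈ strictValueSet s f h) :
      r * p < ∑ i, μ i * u i + r * t := by
    simpa [hφ_apply] using hφ _ hut
  obtain ⟨x₀, hx₀, hhx₀⟩ := hs
  have hpx₀ : p ≤ f x₀ := hp x₀ hx₀ fun i => (hhx₀ i).le
  have hr_pos : 0 < r := by
    have := hsep 0 (f x₀ + 1) ⟨x₀, hx₀, hhx₀, by simp⟩
    simp only [Pi.zero_apply, mul_zero, Finset.sum_const_zero, zero_add] at this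
    nlinarith
  have hμ_nonneg (i : ι) : 0 ≤ μ i := by
    have hray (c : ℝ) (hc : 0 ≤ c) : r * p < μ i * c + r * (f x₀ + 1) := by
      have hsingle : (0 : ι → ℝ) ≤ Pi.single i c := Pi.single_nonneg.2 hc
      have := hsep (Pi.single i c) (f x₀ + 1)
        ⟨x₀, hx₀, fun j => (hhx₀ j).trans_le (hsingle j), by simp⟩
      simpa [Pi.single_apply] using this
    by_contra! hneg
    have hb : 0 ≤ r * (f x₀ + 1) - r * p := by nlinarith
    have := hray ((r * (f x₀ + 1) - r * p) / -μ i) (div_nonneg hb (by linarith))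
    rw [div_neg, mul_neg, mul_div_cancel₀ _ hneg.ne] at this
    linarith
  have hle (x : E) (hx : x ∈ s) : r * p ≤ ∑ i, μ i * h x i + r * f x := by
    have hlim : Filter.Tendsto (fun c : ℝ => ∑ i, μ i * (h x i + c) + r * (f x + c))
        (nhdsWithin 0 (Set.Ioi 0)) (nhds (∑ i, μ i * h x i + r * f x)) := by
      have hcont : Continuous fun c : ℝ => ∑ i, μ i * (h x i + c) + r * (f x + c) := by
        fun_prop
      simpa using (hcont.tendsto 0).mono_left nhdsWithin_le_nhds
    refine ge_of_tendsto hlim ?_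
    filter_upwards [self_mem_nhdsWithin] with c hc
    rw [Set.mem_Ioi] at hc
    exact (hsep (fun i => h x i + c) (f x + c)
      ⟨x, hx, fun i => lt_add_of_pos_right _ hc, lt_add_of_pos_right _ hc⟩).le
  refine ⟨fun i => μ i / r, fun i => div_nonneg (hμ_nonneg i) hr_pos.le, fun x hx => ?_⟩
  have hscale : r * (f x + ∑ i, μ i / r * h x i) = ∑ i, μ i * h x i + r * f x := by
    rw [mul_add, Finset.mul_sum, add_comm]
    congr 1
    exact Finset.sum_congr rfl fun i _ => by field_simp
  exact le_of_mul_le_mul_left ((hle x hx).trans_eq hscale.symm) hr_pos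

end SlaterCondition


/-- Finite-constraint version of Proposition 1 (strong duality via Slater's condition):
for a convex constrained problem with a strictly feasible point and finite primal optimal
value `p₀`, there exists a nonnegative dual multiplier `lam` such that the Lagrangian at
`lam` lower-bounds `p₀` everywhere on `Θ`, and the dual value at `lam` equals `p₀`. -/
theorem slater_strong_duality
    {E : Type*} [AddCommGroup E] [Module ℝ E]
    (Θ : Set E) (hΘ_ne : Θ.Nonempty) (hΘ_conv : Convex ℝ Θ)
    (ℓ : E → ℝ) (hℓ_conv : ConvexOn ℝ Θ ℓ)
    (n : ℕ) (g : E → Fin n → ℝ)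
    (hg_conv : ∀ i, ConvexOn ℝ Θ (fun θ => g θ i))
    (ε : Fin n → ℝ)
    (hslater : ∃ θ' ∈ Θ, ∀ i, g θ' i < ε i)
    (p₀ : ℝ)
    (hp₀_lb : ∀ θ ∈ Θ, (∀ i, g θ i ≤ ε i) → p₀ ≤ ℓ θ)
    (hp₀_inf : p₀ = sInf (ℓ '' {θ ∈ Θ | ∀ i, g θ i ≤ ε i})) :
    ∃ lam : Fin n → ℝ, (∀ i, 0 ≤ lam i) ∧
      (∀ θ ∈ Θ, p₀ ≤ ℓ θ + ∑ i, lam i * (g θ i - ε i)) ∧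
      sInf ((fun θ => ℓ θ + ∑ i, lam i * (g θ i - ε i)) '' Θ) = p₀ := by
  obtain ⟨lam, hlam, hle⟩ := hℓ_conv.exists_lagrange_multiplier (h := fun θ i => g θ i - ε i)
    (fun i => (hg_conv i).add_const (-ε i))
    (by simpa using hslater) (p := p₀) (by simpa using hp₀_lb)
  refine ⟨lam, hlam, hle, le_antisymm ?_ ?_⟩
  · obtain ⟨θ', hθ', hgθ'⟩ := hslater
    conv_rhs => rw [hp₀_inf]
    refine le_csInf ⟨_, θ', ⟨hθ', fun i => (hgθ' i).le⟩, rfl⟩ ?_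
    rintro _ ⟨θ, ⟨hθ, hgθ⟩, rfl⟩
    refine (csInf_le ⟨p₀, Set.forall_mem_image.2 hle⟩ (Set.mem_image_of_mem _ hθ)).trans ?_
    exact add_le_of_nonpos_right <| Finset.sum_nonpos fun i _ =>
      mul_nonpos_of_nonneg_of_nonpos (hlam i) (sub_nonpos.2 (hgθ i))
  · exact le_csInf (hΘ_ne.image _) (Set.forall_mem_image.2 hle)
end
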